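/- Let Ū and U be n×d real matrices with orthonormal columns such that ŪᵀU is invertible. Let s ∈ ℝ^d, v = Ūs, w = Uᵀv, v_∥ = UUᵀv, v_⊥ = v − v_∥, with v_∥ ≠ 0 and v_⊥ ≠ 0. With the greedy step angle θ* = arctan(‖v_⊥‖/‖v_∥‖), the GROUSE update U₊ = U + (cos θ* · v_∥/‖v_∥‖ + sin θ* · v_⊥/‖v_⊥‖ − v_∥/‖v_∥‖) wᵀ/‖w‖ satisfies ζ(U₊) = (1 + ‖v_⊥‖²/‖v_∥‖²) · ζ(U); in particular ζ(U₊) ≥ ζ(U). -/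

import Mathlib

open Matrix

/-- The Euclidean (ℓ²) norm of a vector in `ℝ^k`. -/
noncomputable def l2norm {k : ℕ} (v : Fin k → ℝ) : ℝ := Real.sqrt (∑ i, v i ^ 2)

/-- Determinant similarity `ζ(M) = det(ŪᵀM MᵀŪ)` relative to a fixed `Ū`. -/
noncomputable def detSim {n d : ℕ} (Ubar M : Matrix (Fin n) (Fin d) ℝ) : ℝ :=
  (Ubarᵀ * M * Mᵀ * Ubar).det

lemma l2norm_sq {k : ℕ} (v : Fin k → ℝ) : l2norm v ^ 2 = v ⬝ᵥ v := by
  rw [l2norm, Real.sq_sqrt (Finset.sum_nonneg fun i _ => sq_nonneg (v i))]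
  simp only [dotProduct, sq]

lemma l2norm_ne_zero {k : ℕ} {v : Fin k → ℝ} (hv : v ≠ 0) : l2norm v ≠ 0 := fun h =>
  hv (dotProduct_self_eq_zero.mp (by rw [← l2norm_sq, h]; norm_num))

lemma detSim_eq_sq {n d : ℕ} (Ubar M : Matrix (Fin n) (Fin d) ℝ) :
    detSim Ubar M = (Ubarᵀ * M).det ^ 2 := by
  rw [detSim, Matrix.mul_assoc, det_mul, ← det_transpose (Mᵀ * Ubar), transpose_mul,
    transpose_transpose, sq]

lemma mulVec_dotProduct_mulVec_of_orthonormal {n d : ℕ} {U : Matrix (Fin n) (Fin d) ℝ}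
    (hU : Uᵀ * U = 1) (x y : Fin d → ℝ) : U *ᵥ x ⬝ᵥ U *ᵥ y = x ⬝ᵥ y := by
  rw [dotProduct_mulVec, ← mulVec_transpose, mulVec_mulVec, hU, one_mulVec]

lemma det_add_vecMulVec_mulVec {d : ℕ} (A : Matrix (Fin d) (Fin d) ℝ) (x y : Fin d → ℝ) :
    (A + vecMulVec (A *ᵥ x) y).det = A.det * (1 + y ⬝ᵥ x) := by
  rw [← mul_vecMulVec, ← det_one_add_replicateCol_mul_replicateRow (ι := Unit),
    ← vecMulVec_eq, ← det_mul, Matrix.mul_add, Matrix.mul_one]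

/-- with the greedy step angle `θ* = arctan(‖v⊥‖/‖v∥‖)`, the GROUSE
update satisfies `ζ(U₊) = (1 + ‖v⊥‖²/‖v∥‖²) ζ(U)`; in particular `ζ(U₊) ≥ ζ(U)`. -/
theorem grouse_greedy_step_detSim {n d : ℕ}
    (Ubar U : Matrix (Fin n) (Fin d) ℝ)
    (hUbar : Ubarᵀ * Ubar = 1) (hU : Uᵀ * U = 1)
    (hinv : IsUnit (Ubarᵀ * U))
    (s : Fin d → ℝ)
    (v : Fin n → ℝ) (hv : v = Ubar.mulVec s)
    (w : Fin d → ℝ) (hw : w = Uᵀ.mulVec v)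
    (vpar : Fin n → ℝ) (hvpar : vpar = (U * Uᵀ).mulVec v)
    (vperp : Fin n → ℝ) (hvperp : vperp = v - vpar)
    (hpar0 : vpar ≠ 0) (hperp0 : vperp ≠ 0)
    (θstar : ℝ) (hθ : θstar = Real.arctan (l2norm vperp / l2norm vpar))
    (Uplus : Matrix (Fin n) (Fin d) ℝ)
    (hUplus : Uplus = U + Matrix.vecMulVec
      (fun i => Real.cos θstar * (vpar i / l2norm vpar)
        + Real.sin θstar * (vperp i / l2norm vperp) - vpar i / l2norm vpar)
      (fun j => w j / l2norm w)) :
    detSim Ubar Uplus = (1 + l2norm vperp ^ 2 / l2norm vpar ^ 2) * detSim Ubar U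
      ∧ detSim Ubar U ≤ detSim Ubar Uplus := by
  have ha : l2norm vpar ≠ 0 := l2norm_ne_zero hpar0
  have hb : l2norm vperp ≠ 0 := l2norm_ne_zero hperp0
  have hparw : vpar = U *ᵥ w := by rw [hvpar, hw, mulVec_mulVec]
  have hww : w ⬝ᵥ w = l2norm vpar ^ 2 := by
    rw [l2norm_sq, hparw, mulVec_dotProduct_mulVec_of_orthonormal hU]
  have hwnorm : l2norm w = l2norm vpar := by
    rw [l2norm, l2norm, ← Real.sqrt_sq (Real.sqrt_nonneg (∑ i, vpar i ^ 2))]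
    change _ = Real.sqrt (l2norm vpar ^ 2)
    rw [← hww]
    simp only [dotProduct, sq]
  have hparv : vpar ⬝ᵥ v = l2norm vpar ^ 2 := by
    rw [← hww, hparw, dotProduct_comm, dotProduct_mulVec, ← mulVec_transpose, ← hw]
  have hpyth : v ⬝ᵥ v = l2norm vpar ^ 2 + l2norm vperp ^ 2 := by
    have h := hparv
    rw [l2norm_sq] at h
    rw [l2norm_sq, l2norm_sq, hvperp, sub_dotProduct, dotProduct_sub, dotProduct_sub,
      dotProduct_comm v vpar, h]
    ring
  have hss : s ⬝ᵥ s = v ⬝ᵥ v := by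
    rw [hv, mulVec_dotProduct_mulVec_of_orthonormal hUbar]
  have hUbarv : Ubarᵀ *ᵥ v = s := by rw [hv, mulVec_mulVec, hUbar, one_mulVec]
  obtain ⟨x, hx⟩ : ∃ x, (Ubarᵀ * U) *ᵥ x = s := mulVec_surjective_iff_isUnit.mpr hinv s
  have hwx : w ⬝ᵥ x = l2norm vpar ^ 2 + l2norm vperp ^ 2 := by
    rw [← hpyth, ← hss]
    nth_rw 2 [← hx]
    rw [hw, hv, mulVec_mulVec, dotProduct_mulVec, ← mulVec_transpose, transpose_mul,
      transpose_transpose]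
  set a := l2norm vpar
  set b := l2norm vperp
  have hsin : Real.sin θstar = Real.cos θstar * (b / a) := by
    rw [hθ, Real.sin_arctan, Real.cos_arctan]
    ring
  have hcos : Real.cos θstar ^ 2 = 1 / (1 + (b / a) ^ 2) := by rw [hθ, Real.cos_sq_arctan]
  have hstep : (fun i => Real.cos θstar * (vpar i / a) + Real.sin θstar * (vperp i / b)
      - vpar i / a) = (Real.cos θstar / a) • v - a⁻¹ • vpar := by
    ext i
    simp only [hsin, hvperp, Pi.sub_apply, Pi.smul_apply, smul_eq_mul]
    field_simp
    ring
  have hplus : Ubarᵀ * Uplus = Ubarᵀ * U + vecMulVec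
      ((Ubarᵀ * U) *ᵥ ((Real.cos θstar / a) • x - a⁻¹ • w)) (a⁻¹ • w) := by
    have hwdiv : (fun j => w j / l2norm w) = a⁻¹ • w := by
      ext j
      simp only [hwnorm, Pi.smul_apply, smul_eq_mul, div_eq_inv_mul]
    rw [hUplus, hstep, hwdiv, Matrix.mul_add, mul_vecMulVec]
    simp only [mulVec_sub, mulVec_smul]
    rw [hUbarv, hx, hparw, mulVec_mulVec]
  have hmain : detSim Ubar Uplus = (1 + b ^ 2 / a ^ 2) * detSim Ubar U := by
    have hfactor : 1 + (a⁻¹ • w) ⬝ᵥ ((Real.cos θstar / a) • x - a⁻¹ • w)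
        = Real.cos θstar * (1 + (b / a) ^ 2) := by
      simp only [smul_dotProduct, dotProduct_sub, dotProduct_smul, smul_eq_mul, hwx, hww]
      field_simp
      ring
    have hpos : 1 + (b / a) ^ 2 ≠ 0 := by positivity
    rw [detSim_eq_sq, detSim_eq_sq, hplus, det_add_vecMulVec_mulVec, hfactor, mul_pow,
      mul_pow, hcos, ← div_pow]
    field_simp
  refine ⟨hmain, ?_⟩
  rw [hmain, detSim_eq_sq]
  exact le_mul_of_one_le_left (sq_nonneg _) (le_add_of_nonneg_right (by positivity))
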